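/- Let (X,d) be a geodesic metric space containing a geodesic triangle with vertices a, b, c and a point p on side [a,b] whose distance to the union of the other two sides exceeds δ. Set R = δ/2. Then there exists a point q on the circle of radius R centered at p such that d(q, ∂T) ≥ R/2, where ∂T is the union of the three sides of the triangle. -/

import Mathlib

open MeasureTheory
open scoped ENNReal Classical

/-- Hilbert Finsler norm `F_C(p,v) = (1/2)‖v‖(1/‖p-p⁻‖+1/‖p-p⁺‖) = (1/2)(1/t⁺+1/t⁻)`
where `t⁺, t⁻` are the exit times of the line through `p` with direction `±v`. -/
noncomputable def hilbertFinsler {E : Type*} [NormedAddCommGroup E] [NormedSpace ℝ E]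
    (C : Set E) (p v : E) : ℝ :=
  if v = 0 then 0 else
    (1 / 2) * (1 / sSup {t : ℝ | 0 < t ∧ p + t • v ∈ C}
      + 1 / sSup {t : ℝ | 0 < t ∧ p - t • v ∈ C})

/-- Unit ball of the Hilbert Finsler norm at `p`. -/
noncomputable def hilbertUnitBall {E : Type*} [NormedAddCommGroup E] [NormedSpace ℝ E]
    (C : Set E) (p : E) : Set E :=
  {v | hilbertFinsler C p v < 1}

/-- Hilbert distance: `d_C(p,q) = (1/2) log [a,p,q,b]`, the cross ratio of the
intersections of the line `pq` with the boundary of `C`, expressed via exit times. -/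
noncomputable def hilbertDist {E : Type*} [NormedAddCommGroup E] [NormedSpace ℝ E]
    (C : Set E) (p q : E) : ℝ :=
  if p = q then 0 else
    (1 / 2) * Real.log
      (((1 + sSup {t : ℝ | 0 < t ∧ p - t • (q - p) ∈ C}) /
          sSup {t : ℝ | 0 < t ∧ p - t • (q - p) ∈ C}) *
        (sSup {t : ℝ | 0 < t ∧ p + t • (q - p) ∈ C} /
          (sSup {t : ℝ | 0 < t ∧ p + t • (q - p) ∈ C} - 1)))

/-- The gauge of `C` seen from the base point `p`. -/
noncomputable def gaugeFrom {E : Type*} [AddCommGroup E] [Module ℝ E]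
    (C : Set E) (p v : E) : ℝ :=
  gauge ((fun w => p + w) ⁻¹' C) v

section GaugeFrom

variable {E : Type*} [NormedAddCommGroup E] {C : Set E} {p q r v : E}

theorem preimage_add_mem_nhds (hopen : IsOpen C) (hp : p ∈ C) :
    (fun w => p + w) ⁻¹' C ∈ nhds (0 : E) :=
  (hopen.preimage (continuous_const.add continuous_id)).mem_nhds (by simpa using hp)

variable [NormedSpace ℝ E]

theorem gaugeFrom_nonneg : 0 ≤ gaugeFrom C p v := gauge_nonneg _

theorem gaugeFrom_zero : gaugeFrom C p 0 = 0 := gauge_zero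

theorem gaugeFrom_smul {t : ℝ} (ht : 0 ≤ t) :
    gaugeFrom C p (t • v) = t * gaugeFrom C p v := by
  simp [gaugeFrom, gauge_smul_of_nonneg ht]

theorem convex_preimage_add (hconv : Convex ℝ C) : Convex ℝ ((fun w => p + w) ⁻¹' C) :=
  hconv.translate_preimage_right p

theorem continuous_gaugeFrom (hopen : IsOpen C) (hconv : Convex ℝ C) (hp : p ∈ C) :
    Continuous (gaugeFrom C p) :=
  continuous_gauge (convex_preimage_add hconv) (preimage_add_mem_nhds hopen hp)

theorem gaugeFrom_lt_one_iff (hopen : IsOpen C) (hconv : Convex ℝ C) (hp : p ∈ C) :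
    gaugeFrom C p v < 1 ↔ p + v ∈ C := by
  have := setOfPred_gauge_lt_one_eq_self_of_isOpen (s := (fun w => p + w) ⁻¹' C)
    (convex_preimage_add hconv)
    (by simpa using hp) (hopen.preimage (continuous_const.add continuous_id))
  exact Set.ext_iff.1 this v

theorem gaugeFrom_add_le (hopen : IsOpen C) (hconv : Convex ℝ C) (hp : p ∈ C) (v w : E) :
    gaugeFrom C p (v + w) ≤ gaugeFrom C p v + gaugeFrom C p w :=
  gauge_add_le (convex_preimage_add hconv)
    (absorbent_nhds_zero (preimage_add_mem_nhds hopen hp)) v w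

theorem gaugeFrom_pos (hopen : IsOpen C) (hbdd : Bornology.IsBounded C)
    (hp : p ∈ C) (hv : v ≠ 0) : 0 < gaugeFrom C p v := by
  refine (gauge_pos (absorbent_nhds_zero (preimage_add_mem_nhds hopen hp)) ?_).2 hv
  rw [NormedSpace.isVonNBounded_iff]
  exact (IsometryEquiv.addLeft p).isometry.antilipschitz.isBounded_preimage hbdd

theorem sSup_exit_times (hopen : IsOpen C) (hconv : Convex ℝ C) (hbdd : Bornology.IsBounded C)
    (hp : p ∈ C) (hv : v ≠ 0) :
    sSup {t : ℝ | 0 < t ∧ p + t • v ∈ C} = (gaugeFrom C p v)⁻¹ := by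
  have hg := gaugeFrom_pos hopen hbdd hp hv
  have : {t : ℝ | 0 < t ∧ p + t • v ∈ C} = Set.Ioo 0 (gaugeFrom C p v)⁻¹ := by
    ext t
    refine and_congr_right fun ht => ?_
    rw [← gaugeFrom_lt_one_iff hopen hconv hp, gaugeFrom_smul ht.le, lt_inv_comm₀ ht hg,
      inv_eq_one_div, lt_div_iff₀' ht]
  rw [this, csSup_Ioo (inv_pos.2 hg)]

theorem hilbertDist_eq_log (hopen : IsOpen C) (hconv : Convex ℝ C) (hbdd : Bornology.IsBounded C)
    (hp : p ∈ C) (hq : q ∈ C) :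
    hilbertDist C p q =
      1 / 2 * Real.log ((1 + gaugeFrom C p (p - q)) / (1 - gaugeFrom C p (q - p))) := by
  rcases eq_or_ne p q with rfl | hne
  · simp [hilbertDist, gaugeFrom_zero]
  have hm : {t : ℝ | 0 < t ∧ p - t • (q - p) ∈ C} = {t : ℝ | 0 < t ∧ p + t • (p - q) ∈ C} := by
    ext t
    simp only [Set.mem_ofPred_eq, ← neg_sub p q, smul_neg, sub_neg_eq_add]
  have h1 := gaugeFrom_pos hopen hbdd hp (sub_ne_zero.2 hne)
  have h2 := gaugeFrom_pos hopen hbdd hp (sub_ne_zero.2 hne.symm)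
  have h3 : gaugeFrom C p (q - p) < 1 := by
    rw [gaugeFrom_lt_one_iff hopen hconv hp]; simpa using hq
  rw [hilbertDist, if_neg hne, hm, sSup_exit_times hopen hconv hbdd hp (sub_ne_zero.2 hne),
    sSup_exit_times hopen hconv hbdd hp (sub_ne_zero.2 hne.symm)]
  congr 2
  have h4 : 1 - gaugeFrom C p (q - p) ≠ 0 := by linarith
  have h5 : (gaugeFrom C p (q - p))⁻¹ - 1 ≠ 0 := by
    have := (one_lt_inv₀ h2).2 h3
    linarith
  field_simp
  ring

theorem gaugeFrom_translate_le (hopen : IsOpen C) (hconv : Convex ℝ C) (hp : p ∈ C)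
    {s : ℝ} (hs : p + s • v ∈ C) :
    gaugeFrom C (p + s • v) v * (1 - s * gaugeFrom C p v) ≤ gaugeFrom C p v := by
  have key : ∀ r, gaugeFrom C p v < r → 0 < 1 - s * r →
      gaugeFrom C (p + s • v) v * (1 - s * r) ≤ r := by
    intro r hr hsr
    have hr0 : 0 < r := gaugeFrom_nonneg.trans_lt hr
    have h1 : p + r⁻¹ • v ∈ C := by
      rw [← gaugeFrom_lt_one_iff hopen hconv hp, gaugeFrom_smul (inv_nonneg.2 hr0.le)]
      rwa [inv_mul_lt_one₀ hr0]
    have h2 : 0 ≤ r⁻¹ - s := by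
      have : r⁻¹ - s = (1 - s * r) / r := by field_simp
      rw [this]; positivity
    have h3 : gaugeFrom C (p + s • v) ((r⁻¹ - s) • v) < 1 := by
      rw [gaugeFrom_lt_one_iff hopen hconv hs]
      convert h1 using 1
      module
    rw [gaugeFrom_smul h2] at h3
    have h4 : gaugeFrom C (p + s • v) v * (1 - s * r) =
        r * ((r⁻¹ - s) * gaugeFrom C (p + s • v) v) := by field_simp
    rw [h4]
    nlinarith
  have hpos : 0 < 1 - s * gaugeFrom C p v := by
    rcases le_total s 0 with h | h
    · nlinarith [gaugeFrom_nonneg (C := C) (p := p) (v := v)]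
    · rw [← gaugeFrom_lt_one_iff hopen hconv hp, gaugeFrom_smul h] at hs
      linarith
  have hev : ∀ᶠ r in nhdsWithin (gaugeFrom C p v) (Set.Ioi (gaugeFrom C p v)),
      gaugeFrom C (p + s • v) v * (1 - s * r) ≤ r := by
    have hc : ContinuousAt (fun r : ℝ => 1 - s * r) (gaugeFrom C p v) := by fun_prop
    filter_upwards [self_mem_nhdsWithin, mem_nhdsWithin_of_mem_nhds (hc.eventually_const_lt hpos)]
      with r h1 h2 using key r h1 h2
  have hl : ContinuousAt (fun r : ℝ => gaugeFrom C (p + s • v) v * (1 - s * r))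
    (gaugeFrom C p v) := by fun_prop
  exact le_of_tendsto_of_tendsto (hl.mono_left nhdsWithin_le_nhds)
    (continuousAt_id.mono_left nhdsWithin_le_nhds) hev

theorem gaugeFrom_translate (hopen : IsOpen C) (hconv : Convex ℝ C) (hp : p ∈ C)
    {s : ℝ} (hs : p + s • v ∈ C) :
    gaugeFrom C (p + s • v) v * (1 - s * gaugeFrom C p v) = gaugeFrom C p v := by
  refine le_antisymm (gaugeFrom_translate_le hopen hconv hp hs) ?_
  have hback : p + s • v + (-s) • v = p := by module
  have := gaugeFrom_translate_le (s := -s) (v := v) hopen hconv hs (by rwa [hback])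
  rw [hback] at this
  linarith

/-- The Funk (asymmetric) metric of a convex domain. -/
noncomputable def funkDist {E : Type*} [AddCommGroup E] [Module ℝ E]
    (C : Set E) (p q : E) : ℝ :=
  -Real.log (1 - gaugeFrom C p (q - p))

theorem one_sub_gaugeFrom_pos (hopen : IsOpen C) (hconv : Convex ℝ C) (hp : p ∈ C) (hq : q ∈ C) :
    0 < 1 - gaugeFrom C p (q - p) := by
  have : gaugeFrom C p (q - p) < 1 := by
    rw [gaugeFrom_lt_one_iff hopen hconv hp]; simpa using hq
  linarith

theorem funkDist_nonneg (hopen : IsOpen C) (hconv : Convex ℝ C) (hp : p ∈ C) (hq : q ∈ C) :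
    0 ≤ funkDist C p q := by
  have h := one_sub_gaugeFrom_pos hopen hconv hp hq
  exact neg_nonneg.2 (Real.log_nonpos h.le (by
    linarith [gaugeFrom_nonneg (C := C) (p := p) (v := q - p)]))

theorem funkDist_triangle (hopen : IsOpen C) (hconv : Convex ℝ C)
    (hp : p ∈ C) (hq : q ∈ C) (hr : r ∈ C) :
    funkDist C p r ≤ funkDist C p q + funkDist C q r := by
  have h1 := one_sub_gaugeFrom_pos hopen hconv hp hq
  have h2 := one_sub_gaugeFrom_pos hopen hconv hq hr
  have key : ∀ s ∈ Set.Ioo (gaugeFrom C q (r - q)) 1,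
      gaugeFrom C p (r - p) ≤ (1 - s) * gaugeFrom C p (q - p) + s := by
    rintro s ⟨hs, hs1⟩
    have hs0 : 0 < s := gaugeFrom_nonneg.trans_lt hs
    have hc : q + s⁻¹ • (r - q) ∈ C := by
      rw [← gaugeFrom_lt_one_iff hopen hconv hq, gaugeFrom_smul (inv_nonneg.2 hs0.le)]
      rwa [inv_mul_lt_one₀ hs0]
    have h3 := one_sub_gaugeFrom_pos hopen hconv hp hc
    have h4 : r - p = (1 - s) • (q - p) + s • (q + s⁻¹ • (r - q) - p) := by
      rw [smul_sub s, smul_add, smul_inv_smul₀ hs0.ne']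
      module
    calc gaugeFrom C p (r - p)
        = gaugeFrom C p ((1 - s) • (q - p) + s • (q + s⁻¹ • (r - q) - p)) := by rw [← h4]
      _ ≤ _ := gaugeFrom_add_le hopen hconv hp _ _
      _ ≤ _ := by
        rw [gaugeFrom_smul (by linarith), gaugeFrom_smul hs0.le]
        nlinarith
  have hlim : gaugeFrom C p (r - p) ≤
      (1 - gaugeFrom C q (r - q)) * gaugeFrom C p (q - p) + gaugeFrom C q (r - q) := by
    have hc : ContinuousAt (fun s : ℝ => (1 - s) * gaugeFrom C p (q - p) + s)
      (gaugeFrom C q (r - q)) := by fun_prop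
    refine ge_of_tendsto (hc.mono_left
      (nhdsWithin_le_nhds (s := Set.Ioi (gaugeFrom C q (r - q))))) ?_
    filter_upwards [Ioo_mem_nhdsGT (show gaugeFrom C q (r - q) < 1 by linarith)] with s hs
      using key s hs
  rw [funkDist, funkDist, funkDist, ← neg_add, neg_le_neg_iff, ← Real.log_mul h1.ne' h2.ne']
  exact Real.log_le_log (mul_pos h1 h2) (by linarith)

theorem funkDist_add_of_ray (hopen : IsOpen C) (hconv : Convex ℝ C) (hp : p ∈ C)
    {s t : ℝ} (hs : 0 ≤ s) (hst : s ≤ t) (hsC : p + s • v ∈ C) (htC : p + t • v ∈ C) :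
    funkDist C p (p + t • v) =
      funkDist C p (p + s • v) + funkDist C (p + s • v) (p + t • v) := by
  have h1 := one_sub_gaugeFrom_pos hopen hconv hp hsC
  have h2 := one_sub_gaugeFrom_pos hopen hconv hsC htC
  rw [funkDist, funkDist, funkDist, ← neg_add, ← Real.log_mul h1.ne' h2.ne']
  have h3 : p + t • v - (p + s • v) = (t - s) • v := by module
  rw [h3, add_sub_cancel_left, add_sub_cancel_left, gaugeFrom_smul hs,
    gaugeFrom_smul (hs.trans hst), gaugeFrom_smul (sub_nonneg.2 hst)]
  have h4 := gaugeFrom_translate hopen hconv hp hsC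
  congr 2
  linear_combination (t - s) * h4

theorem funkDist_swap (hopen : IsOpen C) (hconv : Convex ℝ C) (hp : p ∈ C) (hq : q ∈ C) :
    funkDist C q p = Real.log (1 + gaugeFrom C p (p - q)) := by
  have h : p + (-1 : ℝ) • (p - q) = q := by module
  have h1 := gaugeFrom_translate (s := -1) (v := p - q) hopen hconv hp (by rwa [h])
  rw [h] at h1
  have h2 : 0 < 1 + gaugeFrom C p (p - q) := by
    linarith [gaugeFrom_nonneg (C := C) (p := p) (v := p - q)]
  rw [funkDist, ← Real.log_inv]
  congr 1
  rw [inv_eq_iff_eq_inv]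
  refine eq_inv_of_mul_eq_one_left ?_
  linear_combination -h1

theorem hilbertDist_eq_funkDist (hopen : IsOpen C) (hconv : Convex ℝ C)
    (hbdd : Bornology.IsBounded C) (hp : p ∈ C) (hq : q ∈ C) :
    hilbertDist C p q = (funkDist C p q + funkDist C q p) / 2 := by
  rw [hilbertDist_eq_log hopen hconv hbdd hp hq, funkDist_swap hopen hconv hp hq, funkDist,
    Real.log_div (by linarith [gaugeFrom_nonneg (C := C) (p := p) (v := p - q)])
      (one_sub_gaugeFrom_pos hopen hconv hp hq).ne']
  ring

theorem hilbertDist_comm (hopen : IsOpen C) (hconv : Convex ℝ C) (hbdd : Bornology.IsBounded C)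
    (hp : p ∈ C) (hq : q ∈ C) : hilbertDist C p q = hilbertDist C q p := by
  rw [hilbertDist_eq_funkDist hopen hconv hbdd hp hq,
    hilbertDist_eq_funkDist hopen hconv hbdd hq hp, add_comm]

theorem hilbertDist_nonneg (hopen : IsOpen C) (hconv : Convex ℝ C) (hbdd : Bornology.IsBounded C)
    (hp : p ∈ C) (hq : q ∈ C) : 0 ≤ hilbertDist C p q := by
  rw [hilbertDist_eq_funkDist hopen hconv hbdd hp hq]
  linarith [funkDist_nonneg hopen hconv hp hq, funkDist_nonneg hopen hconv hq hp]

theorem hilbertDist_triangle (hopen : IsOpen C) (hconv : Convex ℝ C)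
    (hbdd : Bornology.IsBounded C) (hp : p ∈ C) (hq : q ∈ C) (hr : r ∈ C) :
    hilbertDist C p r ≤ hilbertDist C p q + hilbertDist C q r := by
  rw [hilbertDist_eq_funkDist hopen hconv hbdd hp hq,
    hilbertDist_eq_funkDist hopen hconv hbdd hq hr,
    hilbertDist_eq_funkDist hopen hconv hbdd hp hr]
  linarith [funkDist_triangle hopen hconv hp hq hr, funkDist_triangle hopen hconv hr hq hp]

theorem hilbertDist_add_of_ray (hopen : IsOpen C) (hconv : Convex ℝ C)
    (hbdd : Bornology.IsBounded C) (hp : p ∈ C)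
    {s t : ℝ} (hs : 0 ≤ s) (hst : s ≤ t) (hsC : p + s • v ∈ C) (htC : p + t • v ∈ C) :
    hilbertDist C p (p + t • v) =
      hilbertDist C p (p + s • v) + hilbertDist C (p + s • v) (p + t • v) := by
  rw [hilbertDist_eq_funkDist hopen hconv hbdd hp hsC,
    hilbertDist_eq_funkDist hopen hconv hbdd hsC htC,
    hilbertDist_eq_funkDist hopen hconv hbdd hp htC,
    funkDist_add_of_ray hopen hconv hp hs hst hsC htC]
  have e0 : p + t • v + t • (-v) = p := by module
  have e1 : p + t • v + (t - s) • (-v) = p + s • v := by module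
  have := funkDist_add_of_ray (v := -v) (s := t - s) (t := t) hopen hconv htC
    (by linarith) (by linarith) (by rwa [e1]) (by rwa [e0])
  rw [e0, e1] at this
  rw [this]
  ring

theorem continuousOn_hilbertDist_right (hopen : IsOpen C) (hconv : Convex ℝ C)
    (hbdd : Bornology.IsBounded C) (hp : p ∈ C) :
    ContinuousOn (fun q => hilbertDist C p q) C := by
  have hg := continuous_gaugeFrom hopen hconv hp
  have h1 : Continuous fun q => gaugeFrom C p (p - q) := hg.comp (by fun_prop)
  have h2 : Continuous fun q => gaugeFrom C p (q - p) := hg.comp (by fun_prop)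
  refine ContinuousOn.congr (f := fun q => 1 / 2 *
    Real.log ((1 + gaugeFrom C p (p - q)) / (1 - gaugeFrom C p (q - p)))) ?_
    fun q hq => hilbertDist_eq_log hopen hconv hbdd hp hq
  refine continuousOn_const.mul (ContinuousOn.log ?_ ?_)
  · exact (continuous_const.add h1).continuousOn.div (continuous_const.sub h2).continuousOn
      fun q hq => (one_sub_gaugeFrom_pos hopen hconv hp hq).ne'
  · intro q hq
    have := one_sub_gaugeFrom_pos hopen hconv hp hq
    have := gaugeFrom_nonneg (C := C) (p := p) (v := p - q)
    positivity

/-- The factor `ρ` for which `p + ρ • v` lies at Hilbert distance `δ / 2` from `p`. -/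
noncomputable def sphereScale {E : Type*} [AddCommGroup E] [Module ℝ E]
    (C : Set E) (p : E) (δ : ℝ) (v : E) : ℝ :=
  (Real.exp δ - 1) / (gaugeFrom C p (-v) + Real.exp δ * gaugeFrom C p v)

theorem sphereScale_pos (hopen : IsOpen C) (hbdd : Bornology.IsBounded C) (hp : p ∈ C)
    {δ : ℝ} (hδ : 0 < δ) (hv : v ≠ 0) : 0 < sphereScale C p δ v := by
  have h1 := gaugeFrom_pos hopen hbdd hp hv
  have h2 := gaugeFrom_pos hopen hbdd hp (neg_ne_zero.2 hv)
  have h3 := Real.one_lt_exp_iff.2 hδ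
  exact div_pos (by linarith) (by positivity)

theorem add_sphereScale_smul_mem (hopen : IsOpen C) (hconv : Convex ℝ C)
    (hbdd : Bornology.IsBounded C) (hp : p ∈ C) {δ : ℝ} (hδ : 0 < δ) (hv : v ≠ 0) :
    p + sphereScale C p δ v • v ∈ C := by
  have h1 := gaugeFrom_pos hopen hbdd hp hv
  have h2 := gaugeFrom_pos hopen hbdd hp (neg_ne_zero.2 hv)
  rw [← gaugeFrom_lt_one_iff hopen hconv hp,
    gaugeFrom_smul (sphereScale_pos hopen hbdd hp hδ hv).le, sphereScale, div_mul_eq_mul_div,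
    div_lt_one (by positivity)]
  linarith

theorem hilbertDist_add_sphereScale_smul (hopen : IsOpen C) (hconv : Convex ℝ C)
    (hbdd : Bornology.IsBounded C) (hp : p ∈ C) {δ : ℝ} (hδ : 0 < δ) (hv : v ≠ 0) :
    hilbertDist C p (p + sphereScale C p δ v • v) = δ / 2 := by
  have h1 := gaugeFrom_pos hopen hbdd hp hv
  have h2 := gaugeFrom_pos hopen hbdd hp (neg_ne_zero.2 hv)
  have h3 := sphereScale_pos hopen hbdd hp hδ hv
  have h4 : p - (p + sphereScale C p δ v • v) = sphereScale C p δ v • (-v) := by module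
  have hmem := add_sphereScale_smul_mem hopen hconv hbdd hp hδ hv
  have h5 := one_sub_gaugeFrom_pos hopen hconv hp hmem
  rw [hilbertDist_eq_log hopen hconv hbdd hp hmem]
  rw [add_sub_cancel_left, gaugeFrom_smul h3.le] at h5
  rw [h4, add_sub_cancel_left, gaugeFrom_smul h3.le, gaugeFrom_smul h3.le]
  have h6 : (1 + sphereScale C p δ v * gaugeFrom C p (-v)) /
      (1 - sphereScale C p δ v * gaugeFrom C p v) = Real.exp δ := by
    rw [div_eq_iff h5.ne', sphereScale]
    have : gaugeFrom C p (-v) + Real.exp δ * gaugeFrom C p v ≠ 0 := by positivity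
    field_simp
    ring
  rw [h6, Real.log_exp]
  ring

theorem continuousOn_add_sphereScale_smul (hopen : IsOpen C) (hconv : Convex ℝ C)
    (hbdd : Bornology.IsBounded C) (hp : p ∈ C) (δ : ℝ) :
    ContinuousOn (fun v => p + sphereScale C p δ v • v) {0}ᶜ := by
  have hg := continuous_gaugeFrom hopen hconv hp
  have h1 : Continuous fun v => gaugeFrom C p (-v) := hg.comp continuous_neg
  refine continuousOn_const.add (ContinuousOn.smul ?_ continuousOn_id)
  refine continuousOn_const.div (h1.add (continuous_const.mul hg)).continuousOn fun v hv => ?_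
  have h2 := gaugeFrom_pos hopen hbdd hp hv
  have h3 := gaugeFrom_pos hopen hbdd hp (neg_ne_zero.2 hv)
  positivity

/-- A point of the sphere of radius `δ / 2` equidistant from the two points of that sphere on
the line through `p` with direction `u`. -/
theorem exists_equidistant_on_sphere (hrank : 1 < Module.rank ℝ E) (hopen : IsOpen C)
    (hconv : Convex ℝ C) (hbdd : Bornology.IsBounded C) (hp : p ∈ C) {δ : ℝ} (hδ : 0 < δ)
    {u : E} (hu : u ≠ 0) :
    ∃ q ∈ C, hilbertDist C p q = δ / 2 ∧
      hilbertDist C (p + sphereScale C p δ (-u) • (-u)) q =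
        hilbertDist C (p + sphereScale C p δ u • u) q := by
  have hmem : ∀ v : E, v ≠ 0 → p + sphereScale C p δ v • v ∈ C := fun v hv =>
    add_sphereScale_smul_mem hopen hconv hbdd hp hδ hv
  have hb := hmem u hu
  have ha := hmem (-u) (neg_ne_zero.2 hu)
  have hq := continuousOn_add_sphereScale_smul hopen hconv hbdd hp δ
  have hself : ∀ x : E, hilbertDist C x x = 0 := fun x => by simp [hilbertDist]
  obtain ⟨v, hv, hveq⟩ := (isConnected_compl_singleton_of_one_lt_rank hrank
    (0 : E)).isPreconnected.intermediate_value₂ (a := -u) (b := u) (neg_ne_zero.2 hu) hu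
    ((continuousOn_hilbertDist_right hopen hconv hbdd ha).comp hq fun v hv => hmem v hv)
    ((continuousOn_hilbertDist_right hopen hconv hbdd hb).comp hq fun v hv => hmem v hv)
    (by
      simp only [Function.comp_apply, hself]
      exact hilbertDist_nonneg hopen hconv hbdd hb ha)
    (by
      simp only [Function.comp_apply, hself]
      exact hilbertDist_nonneg hopen hconv hbdd ha hb)
  exact ⟨_, hmem v hv, hilbertDist_add_sphereScale_smul hopen hconv hbdd hp hδ hv, hveq⟩

/-- If `q` and `p + s • v` are both at distance `R` from `p` and at least `R` apart, then `q` is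
at distance at least `R / 2` from the ray from `p` in the direction `v`. -/
theorem half_le_hilbertDist_of_ray (hopen : IsOpen C) (hconv : Convex ℝ C)
    (hbdd : Bornology.IsBounded C) (hp : p ∈ C) (hq : q ∈ C) {R s t : ℝ}
    (hs : 0 ≤ s) (ht : 0 ≤ t) (hsC : p + s • v ∈ C) (htC : p + t • v ∈ C)
    (hpq : hilbertDist C p q = R) (hps : hilbertDist C p (p + s • v) = R)
    (hsq : R ≤ hilbertDist C (p + s • v) q) :
    R / 2 ≤ hilbertDist C q (p + t • v) := by
  have h1 := hilbertDist_triangle hopen hconv hbdd hp hq htC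
  have h2 := hilbertDist_triangle hopen hconv hbdd hp htC hq
  have h3 := hilbertDist_triangle hopen hconv hbdd hsC htC hq
  have h4 := hilbertDist_comm hopen hconv hbdd hq htC
  rcases le_total s t with hst | hst
  · have := hilbertDist_add_of_ray hopen hconv hbdd hp hs hst hsC htC
    linarith
  · have := hilbertDist_add_of_ray hopen hconv hbdd hp ht hst htC hsC
    have := hilbertDist_comm hopen hconv hbdd hsC htC
    linarith

end GaugeFrom

theorem stmt_17 (C : Set (ℝ × ℝ)) (hopen : IsOpen C) (hconv : Convex ℝ C)
    (hbdd : Bornology.IsBounded C) (hstrict : StrictConvex ℝ (closure C))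
    (a b c : ℝ × ℝ) (ha : a ∈ C) (hb : b ∈ C) (hc : c ∈ C)
    (δ : ℝ) (hδ : 0 < δ) (p : ℝ × ℝ) (hp : p ∈ segment ℝ a b)
    (hfar : ∀ x ∈ segment ℝ b c ∪ segment ℝ c a, δ < hilbertDist C p x) :
    ∃ q ∈ C, hilbertDist C p q = δ / 2 ∧
      ∀ x ∈ segment ℝ a b ∪ segment ℝ b c ∪ segment ℝ c a,
        δ / 2 / 2 ≤ hilbertDist C q x := by
  have hpC : p ∈ C := hconv.segment_subset ha hb hp
  have hself : hilbertDist C p p = 0 := by simp [hilbertDist]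
  have hpa : p ≠ a := by
    rintro rfl
    have := hfar p (Or.inr (right_mem_segment ℝ c p))
    linarith
  have hpb : p ≠ b := by
    rintro rfl
    have := hfar p (Or.inl (left_mem_segment ℝ p c))
    linarith
  have hu : b - p ≠ 0 := sub_ne_zero.2 hpb.symm
  set u := b - p with hu_def
  have hrank : 1 < Module.rank ℝ (ℝ × ℝ) := by
    rw [rank_prod', Module.rank_self]
    norm_num
  obtain ⟨q, hqC, hpq, heq⟩ :=
    exists_equidistant_on_sphere hrank hopen hconv hbdd hpC hδ hu
  have hbC := add_sphereScale_smul_mem hopen hconv hbdd hpC hδ hu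
  have haC := add_sphereScale_smul_mem hopen hconv hbdd hpC hδ (neg_ne_zero.2 hu)
  have hb0 := (sphereScale_pos hopen hbdd hpC hδ hu).le
  have ha0 := (sphereScale_pos hopen hbdd hpC hδ (neg_ne_zero.2 hu)).le
  have hbd := hilbertDist_add_sphereScale_smul hopen hconv hbdd hpC hδ hu
  have had := hilbertDist_add_sphereScale_smul hopen hconv hbdd hpC hδ (neg_ne_zero.2 hu)
  generalize sphereScale C p δ u = β at *
  generalize sphereScale C p δ (-u) = α at *
  have hab : hilbertDist C (p + α • -u) (p + β • u) = δ := by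
    have e0 : p + α • -u + α • u = p := by module
    have e1 : p + α • -u + (α + β) • u = p + β • u := by module
    have := hilbertDist_add_of_ray (v := u) (s := α) (t := α + β) hopen hconv hbdd haC ha0
      (by linarith) (by rwa [e0]) (by rwa [e1])
    rw [e0, e1, hilbertDist_comm hopen hconv hbdd haC hpC] at this
    linarith
  have htri := hilbertDist_triangle hopen hconv hbdd haC hqC hbC
  rw [hilbertDist_comm hopen hconv hbdd hqC hbC] at htri
  refine ⟨q, hqC, hpq, ?_⟩
  have hside : ∀ x ∈ segment ℝ b c ∪ segment ℝ c a, x ∈ C → δ / 2 / 2 ≤ hilbertDist C q x := by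
    intro x hx hxC
    have := hfar x hx
    have := hilbertDist_triangle hopen hconv hbdd hpC hqC hxC
    linarith
  rintro x ((hx | hx) | hx)
  · have hxC := hconv.segment_subset ha hb hx
    obtain ⟨t, rfl⟩ : ∃ t : ℝ, x = p + t • u := by
      obtain ⟨m, n, hm, hn, hmn, rfl⟩ := hp
      obtain ⟨m', n', hm', hn', hmn', rfl⟩ := hx
      have hm0 : m ≠ 0 := by
        rintro rfl
        obtain rfl : n = 1 := by linarith
        simp at hpb
      refine ⟨(n' - n) / m, ?_⟩
      have e : u = m • (b - a) := by
        rw [hu_def, show n = 1 - m by linarith]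
        module
      rw [e, smul_smul, div_mul_cancel₀ _ hm0, show n = 1 - m by linarith,
        show n' = 1 - m' by linarith]
      module
    rcases le_total 0 t with ht | ht
    · exact half_le_hilbertDist_of_ray hopen hconv hbdd hpC hqC hb0 ht hbC hxC hpq hbd
        (by linarith)
    · have e : p + t • u = p + (-t) • -u := by module
      rw [e] at hxC ⊢
      exact half_le_hilbertDist_of_ray hopen hconv hbdd hpC hqC ha0 (by linarith) haC hxC hpq had
        (by linarith)
  · exact hside x (Or.inl hx) (hconv.segment_subset hb hc hx)
  · exact hside x (Or.inr hx) (hconv.segment_subset hc ha hx)
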